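/- Let ι be a finite index set, fix i ∈ ι, let h > 0, let a : ι → ℝ satisfy a(j) ≥ 0 for all j, and let σ² > 0. Then the function f : (ι → ℝ) → ℝ defined by f(x) = log(h) + x(i) − log( (∑_{j ∈ ι} a(j)·exp(x(j))) + σ² ) is concave on all of ℝ^ι (log denoting the natural logarithm). -/

import Mathlib

/-- Weighted AM-GM for exponentials, normalised by positive constants `S` and `T`. -/
theorem exp_combo_le {S T s t : ℝ} (hS : 0 < S) (hT : 0 < T) (hs : 0 ≤ s) (ht : 0 ≤ t)
    (hst : s + t = 1) (u v : ℝ) :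
    Real.exp (s * u + t * v) ≤
      (s * (Real.exp u / S) + t * (Real.exp v / T)) *
        Real.exp (s * Real.log S + t * Real.log T) := by
  have key := convexOn_exp.2 (Set.mem_univ (u - Real.log S)) (Set.mem_univ (v - Real.log T))
    hs ht hst
  simp only [smul_eq_mul, Real.exp_sub, Real.exp_log hS, Real.exp_log hT] at key
  calc Real.exp (s * u + t * v)
      = Real.exp (s * (u - Real.log S) + t * (v - Real.log T)) *
          Real.exp (s * Real.log S + t * Real.log T) := by
        rw [← Real.exp_add]; ring_nf
    _ ≤ _ := by gcongr

/-- A weighted log-sum-exp shifted by a positive constant is convex. -/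
theorem convexOn_log_sum_mul_exp_add {ι : Type*} [Fintype ι] {a : ι → ℝ} (ha : ∀ j, 0 ≤ a j)
    {c : ℝ} (hc : 0 < c) :
    ConvexOn ℝ Set.univ
      (fun x : ι → ℝ => Real.log ((∑ j, a j * Real.exp (x j)) + c)) := by
  have hpos (x : ι → ℝ) : 0 < (∑ j, a j * Real.exp (x j)) + c :=
    add_pos_of_nonneg_of_pos
      (Finset.sum_nonneg fun j _ => mul_nonneg (ha j) (Real.exp_pos _).le) hc
  refine ⟨convex_univ, fun x _ y _ s t hs ht hst => ?_⟩
  simp only [smul_eq_mul, Pi.add_apply, Pi.smul_apply]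
  have hS := hpos x
  have hT := hpos y
  set S := (∑ j, a j * Real.exp (x j)) + c with hS_def
  set T := (∑ j, a j * Real.exp (y j)) + c with hT_def
  set E := Real.exp (s * Real.log S + t * Real.log T)
  rw [Real.log_le_iff_le_exp (hpos fun j => s * x j + t * y j)]
  have noise := exp_combo_le hS hT hs ht hst 0 0
  simp only [mul_zero, add_zero, Real.exp_zero] at noise
  calc (∑ j, a j * Real.exp (s * x j + t * y j)) + c
      ≤ (∑ j, a j * ((s * (Real.exp (x j) / S) + t * (Real.exp (y j) / T)) * E)) +
          c * ((s * (1 / S) + t * (1 / T)) * E) := by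
        refine add_le_add (Finset.sum_le_sum fun j _ => ?_)
          (le_mul_of_one_le_right hc.le noise)
        exact mul_le_mul_of_nonneg_left (exp_combo_le hS hT hs ht hst _ _) (ha j)
    _ = (s * (S / S) + t * (T / T)) * E := by
        have hsum : (∑ j, a j * ((s * (Real.exp (x j) / S) + t * (Real.exp (y j) / T)) * E)) =
            (s / S * E) * (∑ j, a j * Real.exp (x j)) +
              (t / T * E) * (∑ j, a j * Real.exp (y j)) := by
          rw [Finset.mul_sum, Finset.mul_sum, ← Finset.sum_add_distrib]
          exact Finset.sum_congr rfl fun j _ => by ring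
        rw [hsum, eq_sub_of_add_eq hS_def.symm, eq_sub_of_add_eq hT_def.symm]
        ring
    _ = E := by rw [div_self hS.ne', div_self hT.ne', mul_one, mul_one, hst, one_mul]

/-- Concavity of the log-SINR after the logarithmic change of power variables:
for a finite index set `ι`, a fixed `i ∈ ι`, signal gain `h > 0`, nonnegative
interference coefficients `a j ≥ 0`, and noise power `σ² > 0`, the function
`x ↦ log h + x i − log((∑ j, a j * exp (x j)) + σ²)` is concave on `ℝ^ι`. -/
theorem concaveOn_log_sinr {ι : Type*} [Fintype ι] (i : ι)
    (h : ℝ) (hh : 0 < h) (a : ι → ℝ) (ha : ∀ j, 0 ≤ a j)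
    (σsq : ℝ) (hσ : 0 < σsq) :
    ConcaveOn ℝ Set.univ
      (fun x : ι → ℝ =>
        Real.log h + x i - Real.log ((∑ j, a j * Real.exp (x j)) + σsq)) := by
  have hlin : ConcaveOn ℝ Set.univ (fun x : ι → ℝ => Real.log h + x i) :=
    (concaveOn_const (Real.log h) convex_univ).add
      ((LinearMap.proj (R := ℝ) (φ := fun _ : ι => ℝ) i).concaveOn convex_univ)
  exact hlin.sub (convexOn_log_sum_mul_exp_add ha hσ)
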